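/- (Lemma 2.14) Under assumptions (A1)–(A3) there exists λ₀ ∈ (0,1] such that for every ω ∈ [0,1] and every ε with |ε| < r₁λ₀²/2, the following holds: for every x ∈ ℝ^{k₁} and every n ∈ ℕ there exists x₀ ∈ ℝ^{k₁} such that the trajectory (x_j,y_j)_{j≥0} of f_{ω,ε} with initial condition (x₀, 0) is defined at least up to step n and satisfies x_n = x. Equivalently, the map x₀ ↦ x-component of the n-th iterate of f_{ω,ε} starting at (x₀,0) is surjective onto ℝ^{k₁}. -/

import Mathlib

open Set

abbrev Euc (k : ℕ) : Type := EuclideanSpace ℝ (Fin k)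

/-- The map `f_{ω,ε}(x,y) = (x + ω·α(ω,ε,x,y), β(ω,ε,x,y))`. -/
noncomputable def fmap {k₁ k₂ : ℕ} (α : ℝ → ℝ → Euc k₁ → Euc k₂ → Euc k₁)
    (β : ℝ → ℝ → Euc k₁ → Euc k₂ → Euc k₂) (ω ε : ℝ)
    (p : Euc k₁ × Euc k₂) : Euc k₁ × Euc k₂ :=
  (p.1 + ω • α ω ε p.1 p.2, β ω ε p.1 p.2)

theorem aux_lip {P H : Type*} [NormedAddCommGroup P] [NormedSpace ℝ P]
    [NormedAddCommGroup H] [NormedSpace ℝ H] (G : P → H) (hG : ContDiff ℝ 2 G)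
    (S : Set P) (hS : Convex ℝ S) (M : ℝ)
    (h1 : ∀ p ∈ S, ‖iteratedFDeriv ℝ 1 G p‖ ≤ M) (p q : P) (hp : p ∈ S) (hq : q ∈ S) :
    ‖G q - G p‖ ≤ M * ‖q - p‖ := by
  refine hS.norm_image_sub_le_of_norm_fderiv_le (𝕜 := ℝ)
    (fun x _ => (hG.differentiable (by norm_num)) x) ?_ hp hq
  intro x hx
  have := h1 x hx
  rwa [← zero_add 1, ← norm_iteratedFDeriv_fderiv, norm_iteratedFDeriv_zero] at this

theorem aux_lip2 {P H : Type*} [NormedAddCommGroup P] [NormedSpace ℝ P]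
    [NormedAddCommGroup H] [NormedSpace ℝ H] (G : P → H) (hG : ContDiff ℝ 2 G)
    (S T : Set P) (hS : Convex ℝ S) (hT : Convex ℝ T) (M : ℝ) (e : P)
    (hTS : ∀ p ∈ T, p ∈ S ∧ p + e ∈ S)
    (h2 : ∀ p ∈ S, ‖iteratedFDeriv ℝ 2 G p‖ ≤ M) (p q : P) (hp : p ∈ T) (hq : q ∈ T) :
    ‖(G (q + e) - G q) - (G (p + e) - G p)‖ ≤ M * ‖e‖ * ‖q - p‖ := by
  have hd : Differentiable ℝ G := hG.differentiable (by norm_num)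
  have hfd : Differentiable ℝ (fderiv ℝ G) :=
    (hG.fderiv_right (m := 1) (by norm_num)).differentiable (by norm_num)
  have key : ∀ x ∈ T, ‖fderiv ℝ G (x + e) - fderiv ℝ G x‖ ≤ M * ‖e‖ := by
    intro x hx
    have := hS.norm_image_sub_le_of_norm_fderiv_le (𝕜 := ℝ) (f := fderiv ℝ G) (C := M)
      (fun x _ => hfd x) ?_ (hTS x hx).1 (hTS x hx).2
    · simpa using this
    · intro y hy
      have := h2 y hy
      rwa [show (2:ℕ) = 0 + 1 + 1 from rfl, ← norm_iteratedFDeriv_fderiv,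
        ← norm_iteratedFDeriv_fderiv, norm_iteratedFDeriv_zero] at this
  refine hT.norm_image_sub_le_of_norm_hasFDerivWithin_le (𝕜 := ℝ)
    (f := fun x => G (x + e) - G x) (f' := fun x => fderiv ℝ G (x + e) - fderiv ℝ G x)
    (fun x _ => ?_) key hp hq
  refine HasFDerivAt.hasFDerivWithinAt ?_
  refine HasFDerivAt.sub ?_ (hd x).hasFDerivAt
  exact (hasFDerivAt_comp_add_right e).2 (hd (x + e)).hasFDerivAt

theorem aux_main {E F H : Type*} [NormedAddCommGroup E] [NormedSpace ℝ E]
    [NormedAddCommGroup F] [NormedSpace ℝ F]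
    [NormedAddCommGroup H] [NormedSpace ℝ H] (g : ℝ → ℝ → E → F → H)
    (hG : ContDiff ℝ 2 (fun p : ℝ × ℝ × E × F => g p.1 p.2.1 p.2.2.1 p.2.2.2))
    (C M : ℝ)
    (hM : ∀ (ω ε : ℝ) (x : E) (y : F), |ω| ≤ C → |ε| ≤ C → ‖y‖ ≤ C → ∀ i : ℕ, i ≤ 2 →
      ‖iteratedFDeriv ℝ i (fun p : ℝ × ℝ × E × F => g p.1 p.2.1 p.2.2.1 p.2.2.2)
        (ω, ε, x, y)‖ ≤ M)
    (ω ε : ℝ) (hω : |ω| ≤ C) (hε : |ε| ≤ C) :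
    (∀ x y, ‖y‖ ≤ C → ‖g ω ε x y - g ω 0 x y‖ ≤ M * |ε|) ∧
    (∀ x y y', ‖y‖ ≤ C → ‖y'‖ ≤ C → ‖g ω 0 x y - g ω 0 x y'‖ ≤ M * ‖y - y'‖) ∧
    (∀ x x' y y', ‖y‖ ≤ C → ‖y'‖ ≤ C →
      ‖(g ω ε x y - g ω 0 x y) - (g ω ε x' y' - g ω 0 x' y')‖
        ≤ M * |ε| * (‖x - x'‖ + ‖y - y'‖)) := by
  have hC : 0 ≤ C := (abs_nonneg _).trans hω
  have h0 : |(0:ℝ)| ≤ C := by simpa using hC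
  have hM0 : 0 ≤ M :=
    (norm_nonneg _).trans (hM 0 0 0 0 h0 h0 (by simpa using hC) 0 (by norm_num))
  set G : ℝ × ℝ × E × F → H := fun p => g p.1 p.2.1 p.2.2.1 p.2.2.2 with hGd
  let S : Set (ℝ × ℝ × E × F) :=
    Metric.closedBall 0 C ×ˢ (Metric.closedBall 0 C ×ˢ (univ ×ˢ Metric.closedBall 0 C))
  let T : Set (ℝ × ℝ × E × F) :=
    Metric.closedBall 0 C ×ˢ ({0} ×ˢ (univ ×ˢ Metric.closedBall 0 C))
  have hS : Convex ℝ S := (convex_closedBall _ _).prod ((convex_closedBall _ _).prod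
    (convex_univ.prod (convex_closedBall _ _)))
  have hT : Convex ℝ T := (convex_closedBall _ _).prod ((convex_singleton _).prod
    (convex_univ.prod (convex_closedBall _ _)))
  have hmem : ∀ (ω ε : ℝ) (x : E) (y : F), (ω, ε, x, y) ∈ S ↔ |ω| ≤ C ∧ |ε| ≤ C ∧ ‖y‖ ≤ C := by
    intro ω ε x y
    simp [S]
  have hmemT : ∀ (ω ε : ℝ) (x : E) (y : F), (ω, ε, x, y) ∈ T ↔ |ω| ≤ C ∧ ε = 0 ∧ ‖y‖ ≤ C := by
    intro ω ε x y
    simp [T]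
  have hb : ∀ i ≤ 2, ∀ p ∈ S, ‖iteratedFDeriv ℝ i G p‖ ≤ M := by
    rintro i hi ⟨a, b, x, y⟩ hp
    obtain ⟨h1, h2, h3⟩ := (hmem _ _ _ _).1 hp
    exact hM a b x y h1 h2 h3 i hi
  have L1 := aux_lip G hG S hS M (hb 1 (by norm_num))
  refine ⟨?_, ?_, ?_⟩
  · intro x y hy
    have := L1 (ω, 0, x, y) (ω, ε, x, y) ((hmem _ _ _ _).2 ⟨hω, h0, hy⟩)
      ((hmem _ _ _ _).2 ⟨hω, hε, hy⟩)
    simpa [G, Prod.norm_def] using this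
  · intro x y y' hy hy'
    have := L1 (ω, 0, x, y') (ω, 0, x, y) ((hmem _ _ _ _).2 ⟨hω, h0, hy'⟩)
      ((hmem _ _ _ _).2 ⟨hω, h0, hy⟩)
    simpa [G, Prod.norm_def] using this
  · intro x x' y y' hy hy'
    have := aux_lip2 G hG S T hS hT M (0, ε, 0, 0) ?_ (hb 2 le_rfl) (ω, 0, x', y') (ω, 0, x, y)
      ((hmemT _ _ _ _).2 ⟨hω, rfl, hy'⟩) ((hmemT _ _ _ _).2 ⟨hω, rfl, hy⟩)
    · have h2 : ‖(g ω ε x y - g ω 0 x y) - (g ω ε x' y' - g ω 0 x' y')‖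
        ≤ M * |ε| * (max ‖x - x'‖ ‖y - y'‖) := by
        simpa [G, Prod.norm_def] using this
      refine h2.trans (mul_le_mul_of_nonneg_left ?_ (by positivity))
      exact max_le (by linarith [norm_nonneg (y - y')]) (by linarith [norm_nonneg (x - x')])
    · rintro ⟨a, b, x, y⟩ hp
      obtain ⟨h1, rfl, h3⟩ := (hmemT _ _ _ _).1 hp
      refine ⟨(hmem _ _ _ _).2 ⟨h1, h0, h3⟩, ?_⟩
      simpa using (hmem a ε x y).2 ⟨h1, hε, h3⟩

/-- A perturbation of the identity by a strict contraction is onto. -/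
theorem aux_surj {E : Type*} [NormedAddCommGroup E] [CompleteSpace E] (g : E → E) (a : ℝ)
    (ha : a < 1) (ha0 : 0 ≤ a) (hg : ∀ x y, ‖g x - g y‖ ≤ a * ‖x - y‖) (z : E) :
    ∃ x, x + g x = z := by
  have hc : ContractingWith ⟨a, ha0⟩ (fun x => z - g x) := by
    refine ⟨by exact_mod_cast ha, LipschitzWith.of_dist_le_mul ?_⟩
    intro x y
    rw [dist_eq_norm, dist_eq_norm, sub_sub_sub_cancel_left, norm_sub_rev]
    exact hg x y
  refine ⟨hc.fixedPoint, ?_⟩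
  have := hc.fixedPoint_isFixedPt
  have h : z - g hc.fixedPoint = hc.fixedPoint := this
  nth_rewrite 1 [← h]
  simp

/-- Lemma 2.14: surjectivity of the `x`-component of the `n`-th iterate of `f_{ω,ε}`
along trajectories starting on `{y = 0}`. -/
theorem stmt13 (k₁ k₂ : ℕ) (r₁ : ℝ) (hr₁ : 0 < r₁)
    (α : ℝ → ℝ → Euc k₁ → Euc k₂ → Euc k₁)
    (β : ℝ → ℝ → Euc k₁ → Euc k₂ → Euc k₂)
    (hαC2 : ContDiff ℝ 2 (fun p : ℝ × ℝ × Euc k₁ × Euc k₂ => α p.1 p.2.1 p.2.2.1 p.2.2.2))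
    (hβC2 : ContDiff ℝ 2 (fun p : ℝ × ℝ × Euc k₁ × Euc k₂ => β p.1 p.2.1 p.2.2.1 p.2.2.2))
    (hA1 : ∀ C : ℝ, ∃ M : ℝ, ∀ (ω ε : ℝ) (x : Euc k₁) (y : Euc k₂),
      |ω| ≤ C → |ε| ≤ C → ‖y‖ ≤ C → ∀ i : ℕ, i ≤ 2 →
        ‖iteratedFDeriv ℝ i (fun p : ℝ × ℝ × Euc k₁ × Euc k₂ => α p.1 p.2.1 p.2.2.1 p.2.2.2)
            (ω, ε, x, y)‖ ≤ M ∧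
        ‖iteratedFDeriv ℝ i (fun p : ℝ × ℝ × Euc k₁ × Euc k₂ => β p.1 p.2.1 p.2.2.1 p.2.2.2)
            (ω, ε, x, y)‖ ≤ M)
    (hA2α : ∀ (ω ω' : ℝ) (x x' : Euc k₁) (y : Euc k₂), α ω 0 x y = α ω' 0 x' y)
    (hA2β : ∀ (ω ω' : ℝ) (x x' : Euc k₁) (y : Euc k₂), β ω 0 x y = β ω' 0 x' y)
    (hA20 : β 0 0 0 0 = 0)
    (hA3inv : ∃ Beq : Euc k₂ ≃L[ℝ] Euc k₂,
      (Beq : Euc k₂ →L[ℝ] Euc k₂) = fderiv ℝ (fun y : Euc k₂ => β 0 0 0 y) 0)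
    (q : ℝ) (hq0 : 0 ≤ q) (hq1 : q < 1)
    (hA3q : ∀ y₁ y₂ : Euc k₂, ‖y₁‖ ≤ r₁ → ‖y₂‖ ≤ r₁ →
      ‖β 0 0 0 y₁ - β 0 0 0 y₂‖ ≤ q * ‖y₁ - y₂‖) :
    ∃ l₀ : ℝ, 0 < l₀ ∧ l₀ ≤ 1 ∧
      ∀ ω ∈ Icc (0:ℝ) 1, ∀ ε : ℝ, |ε| < r₁ * l₀ ^ 2 / 2 →
        ∀ (x : Euc k₁) (n : ℕ), ∃ x₀ : Euc k₁,
          (∀ j : ℕ, j ≤ n → ‖((fmap α β ω ε)^[j] (x₀, (0 : Euc k₂))).2‖ ≤ r₁) ∧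
          ((fmap α β ω ε)^[n] (x₀, (0 : Euc k₂))).1 = x := by
  have hq' : 0 < 1 - q := by linarith
  obtain ⟨M₀, hM₀⟩ := hA1 (max 1 r₁)
  set C := max 1 r₁ with hC
  obtain ⟨M, hM1, hMM⟩ : ∃ M : ℝ, 1 ≤ M ∧ M₀ ≤ M := ⟨max 1 M₀, le_max_left _ _, le_max_right _ _⟩
  have hMp : 0 < M := by linarith
  obtain ⟨L, hL⟩ : ∃ L : ℝ, L = (1 - q) / (4 * M) := ⟨_, rfl⟩
  have hL0 : 0 < L := by rw [hL]; positivity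
  have hML : M * L = (1 - q) / 4 := by rw [hL]; field_simp
  have hL1 : L ≤ 1 / 4 := by nlinarith
  obtain ⟨e, he0, he1, he2, he3⟩ : ∃ e : ℝ, 0 < e ∧ e ≤ 1 ∧ 8 * (M * e) ≤ (1 - q) * L ∧
      M * e ≤ (1 - q) * r₁ := by
    refine ⟨min 1 (min ((1 - q) * L / (8 * M)) ((1 - q) * r₁ / M)), ?_, min_le_left _ _, ?_, ?_⟩
    · refine lt_min one_pos (lt_min ?_ ?_) <;> positivity
    · have : min 1 (min ((1 - q) * L / (8 * M)) ((1 - q) * r₁ / M)) ≤ (1 - q) * L / (8 * M) :=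
        (min_le_right _ _).trans (min_le_left _ _)
      rw [le_div_iff₀ (by positivity)] at this
      linarith
    · have : min 1 (min ((1 - q) * L / (8 * M)) ((1 - q) * r₁ / M)) ≤ (1 - q) * r₁ / M :=
        (min_le_right _ _).trans (min_le_right _ _)
      rw [le_div_iff₀ (by positivity)] at this
      linarith
  have hlp : 0 < min 1 (e / r₁) := lt_min one_pos (by positivity)
  refine ⟨min 1 (e / r₁), hlp, min_le_left _ _, ?_⟩
  intro ω hω ε hε'
  have hε : |ε| ≤ e := by
    have h1 : min 1 (e / r₁) ≤ 1 := min_le_left _ _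
    have h2 : min 1 (e / r₁) ≤ e / r₁ := min_le_right _ _
    rw [le_div_iff₀ hr₁] at h2
    set l := min 1 (e / r₁)
    have h3 : r₁ * l ^ 2 ≤ r₁ * l := mul_le_mul_of_nonneg_left (by nlinarith) hr₁.le
    nlinarith
  have hωC : |ω| ≤ C := by
    rw [abs_of_nonneg hω.1]; exact hω.2.trans (le_max_left _ _)
  have hεC : |ε| ≤ C := (hε.trans he1).trans (le_max_left _ _)
  have hrC : r₁ ≤ C := le_max_right _ _
  obtain ⟨-, a2, a3⟩ := aux_main α hαC2 C M
    (fun a b x y h1 h2 h3 i hi => ((hM₀ a b x y h1 h2 h3 i hi).1.trans hMM)) ω ε hωC hεC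
  obtain ⟨b1, -, b3⟩ := aux_main β hβC2 C M
    (fun a b x y h1 h2 h3 i hi => ((hM₀ a b x y h1 h2 h3 i hi).2.trans hMM)) ω ε hωC hεC
  have hMε : M * |ε| ≤ M * e := mul_le_mul_of_nonneg_left hε hMp.le
  set d := M * e with hd
  have hd0 : 0 < d := by positivity
  have hα : ∀ x x' y y', ‖y‖ ≤ r₁ → ‖y'‖ ≤ r₁ → ‖α ω ε x y - α ω ε x' y'‖ ≤
      d * (‖x - x'‖ + ‖y - y'‖) + M * ‖y - y'‖ := by
    intro x x' y y' hy hy'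
    have h1 := a3 x x' y y' (hy.trans hrC) (hy'.trans hrC)
    have h2 := a2 x y y' (hy.trans hrC) (hy'.trans hrC)
    rw [hA2α ω ω x x' y'] at h2
    have h3 : α ω ε x y - α ω ε x' y' = ((α ω ε x y - α ω 0 x y) - (α ω ε x' y' - α ω 0 x' y'))
      + (α ω 0 x y - α ω 0 x' y') := by abel
    rw [h3]
    refine (norm_add_le _ _).trans (add_le_add (h1.trans ?_) h2)
    exact mul_le_mul_of_nonneg_right hMε (by positivity)
  have hβ : ∀ x x' y y', ‖y‖ ≤ r₁ → ‖y'‖ ≤ r₁ → ‖β ω ε x y - β ω ε x' y'‖ ≤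
      d * (‖x - x'‖ + ‖y - y'‖) + q * ‖y - y'‖ := by
    intro x x' y y' hy hy'
    have h1 := b3 x x' y y' (hy.trans hrC) (hy'.trans hrC)
    have h2 := hA3q y y' hy hy'
    rw [hA2β 0 ω 0 x y, hA2β 0 ω 0 x' y'] at h2
    have h3 : β ω ε x y - β ω ε x' y' = ((β ω ε x y - β ω 0 x y) - (β ω ε x' y' - β ω 0 x' y'))
      + (β ω 0 x y - β ω 0 x' y') := by abel
    rw [h3]
    refine (norm_add_le _ _).trans (add_le_add (h1.trans ?_) h2)
    exact mul_le_mul_of_nonneg_right hMε (by positivity)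
  have hβr : ∀ x y, ‖y‖ ≤ r₁ → ‖β ω ε x y‖ ≤ r₁ := by
    intro x y hy
    have h1 := b1 x y (hy.trans hrC)
    have h2 := hA3q y 0 hy (by simpa using hr₁.le)
    rw [hA20, hA2β 0 ω 0 x y, sub_zero, sub_zero] at h2
    have h3 : β ω ε x y = (β ω ε x y - β ω 0 x y) + β ω 0 x y := by abel
    rw [h3]
    refine (norm_add_le _ _).trans ?_
    nlinarith
  obtain ⟨a, haeq⟩ : ∃ a : ℝ, a = d * (1 + L) + M * L := ⟨_, rfl⟩
  have hdL : d * L ≤ d * (1 / 4) := mul_le_mul_of_nonneg_left hL1 hd0.le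
  have hqL : (1 - q) * L ≤ 1 / 4 := by nlinarith
  have ha0 : 0 ≤ a := by rw [haeq]; positivity
  have ha1 : a < 1 := by
    rw [haeq]; nlinarith
  have hfin : d * (1 + L) + q * L ≤ L * (1 - a) := by
    have e1 : M * L * L = (1 - q) / 4 * L := by rw [hML]
    have e2 : d * L * L ≤ d * (1 / 4) := by nlinarith
    rw [haeq]; nlinarith
  have main : ∀ n : ℕ, ∃ (φ : Euc k₁ → Euc k₂) (ψ : Euc k₁ → Euc k₁),
      (∀ x x', ‖φ x - φ x'‖ ≤ L * ‖x - x'‖) ∧ (∀ x, ‖φ x‖ ≤ r₁) ∧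
      (∀ x, (fmap α β ω ε)^[n] (ψ x, 0) = (x, φ x)) ∧
      (∀ x, ∀ j ≤ n, ‖((fmap α β ω ε)^[j] (ψ x, (0 : Euc k₂))).2‖ ≤ r₁) := by
    intro n
    induction n with
    | zero =>
      refine ⟨fun _ => 0, id, ?_, ?_, ?_, ?_⟩
      · intro x x'; simp only [sub_zero, norm_zero]; positivity
      · intro x; simpa using hr₁.le
      · intro x; rfl
      · intro x j hj
        obtain rfl : j = 0 := by omega
        simpa using hr₁.le
    | succ n ih =>
      obtain ⟨φ, ψ, h1, h2, h3, h4⟩ := ih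
      have hg : ∀ x x', ‖ω • α ω ε x (φ x) - ω • α ω ε x' (φ x')‖ ≤ a * ‖x - x'‖ := by
        intro x x'
        rw [← smul_sub, norm_smul, Real.norm_eq_abs, abs_of_nonneg hω.1]
        have k1 := hα x x' _ _ (h2 x) (h2 x')
        have k2 := h1 x x'
        have k3 : ω * ‖α ω ε x (φ x) - α ω ε x' (φ x')‖ ≤ 1 * ‖α ω ε x (φ x) - α ω ε x' (φ x')‖ :=
          mul_le_mul_of_nonneg_right hω.2 (norm_nonneg _)
        have k4 := mul_le_mul_of_nonneg_left k2 hd0.le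
        have k5 := mul_le_mul_of_nonneg_left k2 hMp.le
        rw [haeq]
        linarith
      choose σ hσ using aux_surj (fun x => ω • α ω ε x (φ x)) a ha1 ha0 hg
      have hstep : ∀ x, (fmap α β ω ε)^[n + 1] (ψ (σ x), 0) = (x, β ω ε (σ x) (φ (σ x))) := by
        intro x
        rw [Function.iterate_succ_apply', h3]
        simp only [fmap]
        rw [hσ x]
      refine ⟨fun x => β ω ε (σ x) (φ (σ x)), fun x => ψ (σ x), ?_, ?_, hstep, ?_⟩
      · intro x x'
        have k1 := hβ (σ x) (σ x') _ _ (h2 (σ x)) (h2 (σ x'))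
        have k2 := h1 (σ x) (σ x')
        have k4 := mul_le_mul_of_nonneg_left k2 hd0.le
        have k5 := mul_le_mul_of_nonneg_left k2 hq0
        have k6 := mul_le_mul_of_nonneg_right hfin (norm_nonneg (σ x - σ x'))
        have k7 : (1 - a) * ‖σ x - σ x'‖ ≤ ‖x - x'‖ := by
          have e1 : σ x - σ x' = (x - x') - (ω • α ω ε (σ x) (φ (σ x))
              - ω • α ω ε (σ x') (φ (σ x'))) := by
            have u := hσ x
            have v := hσ x'
            rw [← eq_sub_iff_add_eq] at u v
            rw [sub_sub_sub_comm, ← u, ← v]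
          have e2 := norm_sub_le (x - x') (ω • α ω ε (σ x) (φ (σ x))
              - ω • α ω ε (σ x') (φ (σ x')))
          rw [← e1] at e2
          have e3 := hg (σ x) (σ x')
          linarith
        have k8 := mul_le_mul_of_nonneg_left k7 hL0.le
        linarith
      · intro x; exact hβr _ _ (h2 _)
      · intro x j hj
        rcases Nat.lt_or_ge j (n + 1) with hlt | hge
        · exact h4 (σ x) j (by omega)
        · obtain rfl : j = n + 1 := by omega
          rw [hstep]
          exact hβr _ _ (h2 _)
  intro x n
  obtain ⟨φ, ψ, -, -, h3, h4⟩ := main n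
  exact ⟨ψ x, h4 x, by rw [h3]⟩
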